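/- Let (X,Φ) be a regular topological flow and let S be a weakly extendable cross-section of time η > 0. The following properties are equivalent: (i) μ(∂^Φ S_η) = 0 for every Φ-invariant Borel probability measure μ (i.e., S has a small flow boundary); (ii) lim_{ζ→0⁺} μ(∂^Φ S_ζ)/ζ = 0 for every Φ-invariant Borel probability measure μ; (iii) (1/T)·#{t ∈ (0,T) : φ_t(x) ∈ ∂^Φ S} → 0 as T → +∞, uniformly in x ∈ X. -/

import Mathlib

open Set Filter Topology MeasureTheory

namespace FlowPaper

variable {X : Type*} [MetricSpace X]

/-- The flow `Φ` is regular when no point is fixed by the whole flow. -/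
def Regular (Φ : Flow ℝ X) : Prop := ∀ x : X, ∃ t : ℝ, Φ t x ≠ x

/-- `φ_I(E) = {φ_t x : t ∈ I, x ∈ E}`. -/
def flowSet (Φ : Flow ℝ X) (I : Set ℝ) (E : Set X) : Set X := ⋃ t ∈ I, Φ t '' E

/-- The `ζ`-cylinder `S_ζ = φ_{[-ζ,ζ]}(S)`. -/
def cyl (Φ : Flow ℝ X) (S : Set X) (ζ : ℝ) : Set X := flowSet Φ (Icc (-ζ) ζ) S

/-- `S` is a cross-section of time `η` if `Φ` is injective on `S × [-η,η]`. -/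
def IsCrossSection (Φ : Flow ℝ X) (S : Set X) (η : ℝ) : Prop :=
  Set.InjOn (fun p : X × ℝ => Φ p.2 p.1) (S ×ˢ Icc (-η) η)

/-- Weakly extendable cross-section of time `η`. -/
def IsWec (Φ : Flow ℝ X) (S : Set X) (η : ℝ) : Prop :=
  IsCrossSection Φ S η ∧ IsCrossSection Φ (closure S) η

/-- The flow interior `Int^Φ(S) = Int(S_η) ∩ S`. -/
def flowInterior (Φ : Flow ℝ X) (S : Set X) (η : ℝ) : Set X := interior (cyl Φ S η) ∩ S

/-- The flow boundary `∂^Φ S = closure S \ Int^Φ(S)`. -/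
def flowBoundary (Φ : Flow ℝ X) (S : Set X) (η : ℝ) : Set X := closure S \ flowInterior Φ S η

/-- `∂^Φ S_ζ = φ_{[-ζ,ζ]}(∂^Φ S)`. -/
def flowBoundaryCyl (Φ : Flow ℝ X) (S : Set X) (η ζ : ℝ) : Set X := cyl Φ (flowBoundary Φ S η) ζ

/-- A cross-section is global when some cylinder covers `X`. -/
def IsGlobal (Φ : Flow ℝ X) (S : Set X) : Prop := ∃ ξ > 0, cyl Φ S ξ = univ

/-- First return time `t_S(x) = inf {t > 0 : φ_t x ∈ S}`. -/
noncomputable def returnTime (Φ : Flow ℝ X) (S : Set X) (x : X) : ℝ :=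
  sInf {t : ℝ | 0 < t ∧ Φ t x ∈ S}

/-- First return map `T_S(x) = φ_{t_S(x)}(x)`. -/
noncomputable def returnMap (Φ : Flow ℝ X) (S : Set X) (x : X) : X := Φ (returnTime Φ S x) x

/-- A measure is `Φ`-invariant when it is invariant under every time `t`-map. -/
def FlowInvariant [MeasurableSpace X] (Φ : Flow ℝ X) (μ : Measure X) : Prop :=
  ∀ t : ℝ, Measure.map (Φ t) μ = μ

/-- A w.e.c. `S` of time `η` has small flow boundary when `∂^Φ S_η` is a null set. -/
def HasSmallFlowBoundary [MeasurableSpace X] (Φ : Flow ℝ X) (S : Set X) (η : ℝ) : Prop :=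
  ∀ μ : Measure X, IsProbabilityMeasure μ → FlowInvariant Φ μ → μ (flowBoundaryCyl Φ S η η) = 0

/-- The small flow boundary property of a flow. -/
def SmallFlowBoundaryProperty [MeasurableSpace X] (Φ : Flow ℝ X) : Prop :=
  ∀ x : X, ∀ S' : Set X, ∀ η : ℝ, 0 < η → IsWec Φ S' η → x ∈ flowInterior Φ S' η →
    ∃ S ⊆ S', x ∈ flowInterior Φ S η ∧ IsWec Φ S η ∧ HasSmallFlowBoundary Φ S η

/-- The frontier of `A` with respect to the topology induced on `B`. -/
def frontierIn (B A : Set X) : Set X :=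
  Subtype.val '' (frontier (Subtype.val ⁻¹' A : Set B))

/-- The times in `(0, T)` at which the orbit of `x` visits `B`. -/
def visits (Φ : Flow ℝ X) (B : Set X) (x : X) (T : ℝ) : Set ℝ :=
  {t : ℝ | t ∈ Ioo 0 T ∧ Φ t x ∈ B}

/-- The uniform distribution on the orbit segment of `x` over the time interval `(0, T]`. -/
noncomputable def empiricalMeasure [MeasurableSpace X] (Φ : Flow ℝ X) (x : X) (T : ℝ) :
    Measure X :=
  Measure.map (fun s => Φ s x) (ENNReal.ofReal T⁻¹ • volume.restrict (Ioc 0 T))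

lemma mem_cyl {Φ : Flow ℝ X} {S : Set X} {ζ : ℝ} {x : X} :
    x ∈ cyl Φ S ζ ↔ ∃ t ∈ Icc (-ζ) ζ, Φ t x ∈ S := by
  simp only [cyl, flowSet, mem_iUnion, mem_image, exists_prop]
  constructor
  · rintro ⟨t, ht, s, hs, rfl⟩
    exact ⟨-t, ⟨by linarith [ht.2], by linarith [ht.1]⟩, by simpa [← Flow.map_add]⟩
  · rintro ⟨t, ht, hs⟩
    exact ⟨-t, ⟨by linarith [ht.2], by linarith [ht.1]⟩, _, hs, by simp [← Flow.map_add]⟩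

lemma cyl_mono (Φ : Flow ℝ X) (S : Set X) {ζ ξ : ℝ} (h : ζ ≤ ξ) : cyl Φ S ζ ⊆ cyl Φ S ξ := by
  intro x hx
  obtain ⟨t, ht, hs⟩ := mem_cyl.1 hx
  exact mem_cyl.2 ⟨t, ⟨by linarith [ht.1], by linarith [ht.2]⟩, hs⟩

lemma continuous_orbit (Φ : Flow ℝ X) (x : X) : Continuous fun s => Φ s x :=
  Φ.continuous continuous_id continuous_const

lemma isClosed_cyl [CompactSpace X] (Φ : Flow ℝ X) {B : Set X} (hB : IsClosed B) (ζ : ℝ) :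
    IsClosed (cyl Φ B ζ) := by
  have h : cyl Φ B ζ = (fun p : X × ℝ => Φ p.2 p.1) '' (B ×ˢ Icc (-ζ) ζ) := by
    ext x
    simp only [cyl, flowSet, mem_iUnion, mem_image, exists_prop, mem_prod, Prod.exists]
    grind
  rw [h]
  exact ((hB.isCompact.prod isCompact_Icc).image
    (Φ.continuous continuous_snd continuous_fst)).isClosed

lemma flowBoundary_eq {Φ : Flow ℝ X} {S : Set X} {η : ℝ} (hη : 0 < η) (hS : IsWec Φ S η) :
    flowBoundary Φ S η = closure S \ interior (cyl Φ S η) := by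
  ext x
  simp only [flowBoundary, flowInterior, Set.mem_sdiff, mem_inter_iff, not_and]
  refine and_congr_right fun hx => ⟨fun h hi => h hi ?_, fun h hi => absurd hi h⟩
  obtain ⟨t, ht, hs⟩ := mem_cyl.1 (interior_subset hi)
  have h := @hS.2 (x, t) ⟨hx, ht⟩ (Φ t x, 0) ⟨subset_closure hs, by simp [hη.le]⟩
    (by simp [Flow.map_zero_apply])
  simp only [Prod.mk.injEq] at h
  rwa [h.1]

lemma isClosed_flowBoundary {Φ : Flow ℝ X} {S : Set X} {η : ℝ} (hη : 0 < η)
    (hS : IsWec Φ S η) : IsClosed (flowBoundary Φ S η) := by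
  rw [flowBoundary_eq hη hS]
  exact isClosed_closure.sdiff isOpen_interior

lemma isCrossSection_flowBoundary {Φ : Flow ℝ X} {S : Set X} {η : ℝ} (hS : IsWec Φ S η) :
    IsCrossSection Φ (flowBoundary Φ S η) η :=
  hS.2.mono (prod_mono sdiff_subset Subset.rfl)

/-- Distinct visits to a cross-section of time `η` are more than `2η` apart. -/
lemma IsCrossSection.eq_of_visits {Φ : Flow ℝ X} {B : Set X} {η : ℝ}
    (hB : IsCrossSection Φ B η) {x : X} {s t : ℝ} (hs : Φ s x ∈ B) (ht : Φ t x ∈ B)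
    (hst : |s - t| ≤ 2 * η) : s = t := by
  rw [abs_le] at hst
  have h := @hB (Φ s x, (t - s) / 2) ⟨hs, by constructor <;> simp only <;> linarith⟩
    (Φ t x, (s - t) / 2) ⟨ht, by constructor <;> simp only <;> linarith⟩ (by
      simp only [← Flow.map_add]
      congr 1
      ring)
  have h2 := congrArg Prod.snd h
  simp only at h2
  linarith

lemma IsCrossSection.finite_visits {Φ : Flow ℝ X} {B : Set X} {η : ℝ} (hη : 0 < η)
    (hB : IsCrossSection Φ B η) (x : X) (T : ℝ) : (visits Φ B x T).Finite := by
  refine Set.Finite.of_injOn (f := fun t => ⌊t / (2 * η)⌋) (t := Icc 0 ⌊T / (2 * η)⌋)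
    (fun t ht => ?_) (fun s hs t ht hst => ?_) (finite_Icc _ _)
  · have h1 := ht.1.1
    have h2 := ht.1.2
    exact ⟨Int.floor_nonneg.2 (by positivity), Int.floor_le_floor (by gcongr)⟩
  · refine hB.eq_of_visits hs.2 ht.2 ?_
    have h := Int.abs_sub_lt_one_of_floor_eq_floor hst
    rw [← sub_div, abs_div, abs_of_pos (show 0 < 2 * η by positivity),
      div_lt_one (by positivity)] at h
    exact h.le

lemma ncard_visits_mul_le {Φ : Flow ℝ X} {B : Set X} {η : ℝ} (hη : 0 < η)
    (hB : IsCrossSection Φ B η) (x : X) (T : ℝ) :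
    (visits Φ B x T).ncard * ENNReal.ofReal η ≤
      volume ((fun s => Φ s x) ⁻¹' cyl Φ B η ∩ Ioc 0 (T + η)) := by
  have hfin := hB.finite_visits hη x T
  have hvol : volume (⋃ t ∈ hfin.toFinset, Ioc t (t + η)) =
      (visits Φ B x T).ncard * ENNReal.ofReal η := by
    rw [measure_biUnion_finset _ fun t _ => measurableSet_Ioc]
    · simp [ncard_eq_toFinset_card _ hfin]
    · intro s hs t ht hst
      have hs' : s ∈ visits Φ B x T := by simpa using hs
      have ht' : t ∈ visits Φ B x T := by simpa using ht
      refine Set.disjoint_left.2 fun r hr hr' => hst (hB.eq_of_visits hs'.2 ht'.2 ?_)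
      rw [abs_le]
      constructor <;> linarith [hr.1, hr.2, hr'.1, hr'.2]
  rw [← hvol]
  refine measure_mono (iUnion₂_subset fun t ht r hr => ?_)
  have ht' : t ∈ visits Φ B x T := by simpa using ht
  refine ⟨mem_cyl.2 ⟨t - r, ⟨by linarith [hr.2], by linarith [hr.1]⟩, ?_⟩, ?_, ?_⟩
  · rw [← Flow.map_add, sub_add_cancel]
    exact ht'.2
  · linarith [hr.1, ht'.1.1]
  · linarith [hr.2, ht'.1.2]

/-- The number of visits to a cross-section is at least the number of visits to its cylinder along
an arithmetic progression of times. -/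
lemma card_filter_le_ncard_visits {Φ : Flow ℝ X} {B : Set X} {η : ℝ} (hη : 0 < η)
    (hB : IsCrossSection Φ B η) (x : X) (n : ℕ) (s : Finset ℕ) (hs : ∀ k ∈ s, k < n)
    (h : ∀ k ∈ s, Φ (3 * η * k + 3 * η / 2) x ∈ cyl Φ B η) :
    s.card ≤ (visits Φ B x (3 * η * n)).ncard := by
  have h' : ∀ k ∈ s, ∃ t ∈ Icc (-η) η, Φ (t + (3 * η * k + 3 * η / 2)) x ∈ B := by
    intro k hk
    obtain ⟨t, ht, htB⟩ := mem_cyl.1 (h k hk)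
    exact ⟨t, ht, by rwa [Flow.map_add]⟩
  choose! f hf hfB using h'
  rw [← ncard_coe_finset]
  refine ncard_le_ncard_of_injOn (fun k : ℕ => f k + (3 * η * k + 3 * η / 2)) ?_ ?_
    (hB.finite_visits hη x _)
  · intro k hk
    have hkn : (k : ℝ) + 1 ≤ n := by exact_mod_cast hs k hk
    have h1 := hf k hk
    have h0 : 0 ≤ 3 * η * (k : ℝ) := by positivity
    have h2 : 3 * η * ((k : ℝ) + 1) ≤ 3 * η * n := by gcongr
    exact ⟨⟨by linarith [h1.1], by linarith [h1.2]⟩, hfB k hk⟩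
  · intro j hj k hk hjk
    have h1 := hf j hj
    have h2 := hf k hk
    simp only at hjk
    have h3 : |(j : ℝ) - k| < 1 := by
      rw [abs_lt]
      constructor <;> nlinarith [h1.1, h1.2, h2.1, h2.2]
    have h4 : |(j : ℤ) - k| < 1 := by exact_mod_cast h3
    have h5 := Int.abs_lt_one_iff.1 h4
    omega

section Measure

variable [MeasurableSpace X] [BorelSpace X]

lemma measure_preimage_flow {Φ : Flow ℝ X} {μ : Measure X} (hμ : FlowInvariant Φ μ) (t : ℝ)
    {A : Set X} (hA : MeasurableSet A) : μ (Φ t ⁻¹' A) = μ A := by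
  conv_rhs => rw [← hμ t]
  rw [Measure.map_apply (Φ.continuous_toFun t).measurable hA]

/-- A cylinder of height `η` is covered by `N + 1` translates of the cylinder of height `η / N`. -/
lemma measure_cyl_le [CompactSpace X] {Φ : Flow ℝ X} {μ : Measure X} (hμ : FlowInvariant Φ μ)
    {B : Set X} (hB : IsClosed B) {η : ℝ} (hη : 0 < η) {N : ℕ} (hN : 0 < N) :
    μ (cyl Φ B η) ≤ (N + 1) * μ (cyl Φ B (η / N)) := by
  have hN' : (0 : ℝ) < N := by exact_mod_cast hN
  have hcov : cyl Φ B η ⊆ ⋃ k ∈ Finset.range (N + 1),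
      Φ ((2 * k + 1) * (η / N) - η) ⁻¹' cyl Φ B (η / N) := by
    intro x hx
    obtain ⟨t, ht, hs⟩ := mem_cyl.1 hx
    have hζ : 0 < η / N := by positivity
    have h0 : 0 ≤ (t + η) / (2 * (η / N)) := div_nonneg (by linarith [ht.1]) (by positivity)
    have h1 := Nat.floor_le h0
    have h2 := Nat.lt_floor_add_one ((t + η) / (2 * (η / N)))
    have h3 : (t + η) / (2 * (η / N)) ≤ N := by
      rw [div_le_iff₀ (by positivity)]
      have : N * (2 * (η / N)) = 2 * η := by field_simp
      linarith [ht.2]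
    rw [le_div_iff₀ (by positivity)] at h1
    rw [div_lt_iff₀ (by positivity)] at h2
    simp only [mem_iUnion, Finset.mem_range, exists_prop]
    refine ⟨⌊(t + η) / (2 * (η / N))⌋₊, Nat.lt_succ_of_le (Nat.floor_le_of_le h3), ?_⟩
    refine mem_cyl.2 ⟨t - ((2 * ⌊(t + η) / (2 * (η / N))⌋₊ + 1) * (η / N) - η), ⟨?_, ?_⟩, ?_⟩
    · linarith
    · linarith
    · rwa [← Flow.map_add, sub_add_cancel]
  calc μ (cyl Φ B η) ≤ _ := measure_mono hcov
    _ ≤ ∑ k ∈ Finset.range (N + 1), μ (Φ ((2 * k + 1) * (η / N) - η) ⁻¹' cyl Φ B (η / N)) :=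
      measure_biUnion_finset_le _ _
    _ = (N + 1) * μ (cyl Φ B (η / N)) := by
      simp [measure_preimage_flow hμ _ (isClosed_cyl Φ hB _).measurableSet]

lemma measure_cyl_eq_zero_iff_tendsto [CompactSpace X] {Φ : Flow ℝ X} {μ : Measure X}
    (hμ : FlowInvariant Φ μ) {B : Set X} (hB : IsClosed B) {η : ℝ} (hη : 0 < η) :
    μ (cyl Φ B η) = 0 ↔ Tendsto (fun ζ : ℝ => μ (cyl Φ B ζ) / ENNReal.ofReal ζ)
      (𝓝[>] 0) (𝓝 0) := by
  constructor
  · intro h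
    refine tendsto_const_nhds.congr' ?_
    filter_upwards [Ioo_mem_nhdsGT hη] with ζ hζ
    rw [measure_mono_null (cyl_mono Φ B hζ.2.le) h, ENNReal.zero_div]
  · intro h
    have hlim : Tendsto (fun N : ℕ => η / N) atTop (𝓝[>] 0) := by
      refine tendsto_nhdsWithin_iff.2 ⟨tendsto_const_div_atTop_nhds_zero_nat η, ?_⟩
      filter_upwards [eventually_gt_atTop 0] with N hN
      exact div_pos hη (by exact_mod_cast hN)
    have h2 := ENNReal.Tendsto.const_mul (a := 2 * ENNReal.ofReal η) (h.comp hlim)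
      (Or.inr (by finiteness))
    rw [mul_zero] at h2
    refine le_antisymm (ge_of_tendsto h2 ?_) zero_le
    filter_upwards [eventually_gt_atTop 0] with N hN
    have hN' : (0 : ℝ) < N := by exact_mod_cast hN
    refine (measure_cyl_le hμ hB hη hN).trans ?_
    have hdiv : ENNReal.ofReal η = N * ENNReal.ofReal (η / N) := by
      rw [← ENNReal.ofReal_natCast, ← ENNReal.ofReal_mul hN'.le]
      congr 1
      field_simp
    have hpos : ENNReal.ofReal (η / N) ≠ 0 := by
      simp only [ne_eq, ENNReal.ofReal_eq_zero, not_le]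
      positivity
    simp only [Function.comp_apply]
    rw [hdiv, mul_assoc, mul_assoc, ENNReal.mul_div_cancel hpos ENNReal.ofReal_ne_top, ← mul_assoc]
    gcongr
    rw [two_mul]
    gcongr
    exact_mod_cast hN

lemma measure_cyl_le_of_ncard_visits_le [CompactSpace X] {Φ : Flow ℝ X} {μ : Measure X}
    [IsProbabilityMeasure μ] (hμ : FlowInvariant Φ μ) {B : Set X} (hBc : IsClosed B) {η : ℝ}
    (hη : 0 < η) (hB : IsCrossSection Φ B η) {n : ℕ} (hn : 0 < n) {ε : ℝ}
    (h : ∀ x, ((visits Φ B x (3 * η * n)).ncard : ℝ) ≤ ε * n) :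
    μ (cyl Φ B η) ≤ ENNReal.ofReal ε := by
  classical
  have hA := (isClosed_cyl Φ hBc η).measurableSet
  have hAk : ∀ k : ℕ, MeasurableSet (Φ (3 * η * k + 3 * η / 2) ⁻¹' cyl Φ B η) := fun k =>
    (Φ.continuous_toFun _).measurable hA
  have hsum : (n : ENNReal) * μ (cyl Φ B η) = ∫⁻ x, ∑ k ∈ Finset.range n,
      (Φ (3 * η * k + 3 * η / 2) ⁻¹' cyl Φ B η).indicator 1 x ∂μ := by
    rw [lintegral_finsetSum _ fun k _ => measurable_one.indicator (hAk k)]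
    simp [lintegral_indicator_one (hAk _), measure_preimage_flow hμ _ hA]
  have hle : (n : ENNReal) * μ (cyl Φ B η) ≤ n * ENNReal.ofReal ε := by
    rw [hsum]
    calc _ ≤ ∫⁻ _, n * ENNReal.ofReal ε ∂μ := by
          refine lintegral_mono fun x => ?_
          have hc := card_filter_le_ncard_visits hη hB x n
            {k ∈ Finset.range n | Φ (3 * η * k + 3 * η / 2) x ∈ cyl Φ B η} (by simp +contextual)
            (by simp)
          have he := ENNReal.ofReal_le_ofReal
            (((Nat.cast_le (α := ℝ)).2 hc).trans ((h x).trans_eq (mul_comm _ _)))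
          rw [ENNReal.ofReal_mul (by positivity), ENNReal.ofReal_natCast,
            ENNReal.ofReal_natCast] at he
          refine le_trans (le_of_eq ?_) he
          simp [Set.indicator_apply, Finset.sum_boole]
      _ = n * ENNReal.ofReal ε := by simp
  exact (ENNReal.mul_le_mul_iff_right (by exact_mod_cast hn.ne') (by finiteness)).1 hle

lemma isProbabilityMeasure_empiricalMeasure (Φ : Flow ℝ X) (x : X) {T : ℝ} (hT : 0 < T) :
    IsProbabilityMeasure (empiricalMeasure Φ x T) := by
  have : IsProbabilityMeasure (ENNReal.ofReal T⁻¹ • volume.restrict (Ioc 0 T)) := by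
    constructor
    simp [← ENNReal.ofReal_mul (inv_nonneg.2 hT.le), inv_mul_cancel₀ hT.ne']
  exact Measure.isProbabilityMeasure_map (continuous_orbit Φ x).measurable.aemeasurable

lemma integral_empiricalMeasure (Φ : Flow ℝ X) (x : X) {T : ℝ} (hT : 0 < T) {f : X → ℝ}
    (hf : Continuous f) :
    ∫ y, f y ∂(empiricalMeasure Φ x T) = T⁻¹ * ∫ s in 0..T, f (Φ s x) := by
  rw [empiricalMeasure, integral_map (continuous_orbit Φ x).measurable.aemeasurable
    hf.measurable.aestronglyMeasurable, integral_smul_measure,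
    ENNReal.toReal_ofReal (inv_nonneg.2 hT.le), intervalIntegral.integral_of_le hT.le, smul_eq_mul]

lemma abs_integral_empiricalMeasure_sub_le (Φ : Flow ℝ X) (x : X) {T : ℝ} (hT : 0 < T)
    (f : BoundedContinuousFunction X ℝ) (t : ℝ) :
    |∫ y, f (Φ t y) ∂(empiricalMeasure Φ x T) - ∫ y, f y ∂(empiricalMeasure Φ x T)| ≤
      2 * |t| * ‖f‖ / T := by
  have hfx : Continuous fun s => f (Φ s x) := f.continuous.comp (continuous_orbit Φ x)
  rw [integral_empiricalMeasure Φ x hT (f := fun y => f (Φ t y))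
    (f.continuous.comp (Φ.continuous_toFun t)),
    integral_empiricalMeasure Φ x hT f.continuous, ← mul_sub]
  have h1 : ∫ s in 0..T, f (Φ t (Φ s x)) = ∫ s in t..(T + t), f (Φ s x) := by
    simp_rw [← Flow.map_add, add_comm t]
    rw [intervalIntegral.integral_comp_add_right (fun s => f (Φ s x)) t, zero_add]
  have h2 : ∀ a b : ℝ, |∫ s in a..b, f (Φ s x)| ≤ ‖f‖ * |b - a| := fun a b =>
    intervalIntegral.norm_integral_le_of_norm_le_const fun s _ => f.norm_coe_le_norm _
  have h3 := h2 t 0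
  have h4 := h2 (T + t) T
  rw [h1, intervalIntegral.integral_interval_sub_interval_comm (hfx.intervalIntegrable _ _)
    (hfx.intervalIntegrable _ _) (hfx.intervalIntegrable _ _), abs_mul, abs_of_pos (inv_pos.2 hT),
    div_eq_inv_mul]
  gcongr
  refine (abs_sub _ _).trans ?_
  simp only [zero_sub, abs_neg, sub_add_cancel_left] at h3 h4
  linarith

/-- **Krylov–Bogolyubov**: weak limits of empirical measures are invariant. -/
lemma flowInvariant_of_tendsto_empiricalMeasure (Φ : Flow ℝ X) {ι : Type*} {l : Filter ι} [l.NeBot]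
    {x : ι → X} {T : ι → ℝ} (hT : Tendsto T l atTop) {ν : ι → ProbabilityMeasure X}
    (hν : ∀ i, (ν i : Measure X) = empiricalMeasure Φ (x i) (T i)) {μ : ProbabilityMeasure X}
    (hlim : Tendsto ν l (𝓝 μ)) : FlowInvariant Φ (μ : Measure X) := by
  intro t
  have hm := (Φ.continuous_toFun t).measurable
  have : IsProbabilityMeasure (Measure.map (Φ t) (μ : Measure X)) :=
    Measure.isProbabilityMeasure_map hm.aemeasurable
  refine ext_of_forall_integral_eq_of_IsFiniteMeasure fun f => ?_
  rw [integral_map hm.aemeasurable f.continuous.measurable.aestronglyMeasurable]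
  rw [ProbabilityMeasure.tendsto_iff_forall_integral_tendsto] at hlim
  have h1 := hlim f
  have h2 := hlim (f.compContinuous ⟨Φ t, Φ.continuous_toFun t⟩)
  have h3 := h2.sub h1
  have h4 : Tendsto (fun i => 2 * |t| * ‖f‖ / T i) l (𝓝 0) := hT.const_div_atTop _
  refine sub_eq_zero.1 (tendsto_nhds_unique h3 (squeeze_zero_norm' ?_ h4))
  filter_upwards [hT.eventually_gt_atTop 0] with i hi
  simp only [hν]
  exact abs_integral_empiricalMeasure_sub_le Φ (x i) hi f t

lemma le_empiricalMeasure_cyl [CompactSpace X] {Φ : Flow ℝ X} {B : Set X} (hBc : IsClosed B)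
    {η : ℝ} (hη : 0 < η) (hB : IsCrossSection Φ B η) (x : X) {T : ℝ} (hT : η ≤ T) {ε : ℝ}
    (h : ε ≤ (visits Φ B x T).ncard / T) :
    ENNReal.ofReal (ε * η / 2) ≤ empiricalMeasure Φ x (T + η) (cyl Φ B η) := by
  have hT0 : 0 < T := hη.trans_le hT
  have hm := (continuous_orbit Φ x).measurable
  have hA := (isClosed_cyl Φ hBc η).measurableSet
  rw [empiricalMeasure, Measure.map_apply hm hA, Measure.smul_apply,
    Measure.restrict_apply (hm hA), smul_eq_mul]
  refine le_trans ?_ (mul_le_mul_right (ncard_visits_mul_le hη hB x T) _)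
  rw [← ENNReal.ofReal_natCast, ← ENNReal.ofReal_mul (by positivity),
    ← ENNReal.ofReal_mul (by positivity)]
  refine ENNReal.ofReal_le_ofReal ?_
  rw [inv_mul_eq_div, le_div_iff₀ (by positivity)]
  have h0 : (0 : ℝ) ≤ (visits Φ B x T).ncard := by positivity
  rw [le_div_iff₀ hT0] at h
  rcases le_total ε 0 with hε | hε
  · have h1 : ε * η / 2 * (T + η) ≤ 0 := mul_nonpos_of_nonpos_of_nonneg (by nlinarith) (by linarith)
    exact h1.trans (by positivity)
  · calc ε * η / 2 * (T + η) ≤ ε * η / 2 * (T + T) := by gcongr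
      _ = ε * T * η := by ring
      _ ≤ _ := by gcongr

lemma exists_forall_visits_lt [CompactSpace X] {Φ : Flow ℝ X} {B : Set X} (hBc : IsClosed B)
    {η : ℝ} (hη : 0 < η) (hB : IsCrossSection Φ B η)
    (h : ∀ μ : Measure X, IsProbabilityMeasure μ → FlowInvariant Φ μ → μ (cyl Φ B η) = 0)
    {ε : ℝ} (hε : 0 < ε) :
    ∃ T₀ > (0 : ℝ), ∀ T ≥ T₀, ∀ x : X, ((visits Φ B x T).ncard : ℝ) / T < ε := by
  by_contra! hc
  have hc' : ∀ n : ℕ, ∃ T : ℝ, η + n ≤ T ∧ ∃ x : X, ε ≤ ((visits Φ B x T).ncard : ℝ) / T :=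
    fun n => hc (η + n) (by positivity)
  choose T hT x hx using hc'
  have hT0 : ∀ n, η ≤ T n := fun n => le_trans (by simp) (hT n)
  let ν : ℕ → ProbabilityMeasure X := fun n => ⟨empiricalMeasure Φ (x n) (T n + η),
    isProbabilityMeasure_empiricalMeasure Φ (x n) (by linarith [hT0 n])⟩
  obtain ⟨μ, -, hμ⟩ := isCompact_univ.ultrafilter_le_nhds ((hyperfilter ℕ).map ν) (by simp)
  have hlim : Tendsto ν (hyperfilter ℕ) (𝓝 μ) := hμ
  have hTlim : Tendsto (fun n => T n + η) (hyperfilter ℕ) atTop := by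
    refine Tendsto.mono_left ?_ Nat.hyperfilter_le_atTop
    exact tendsto_atTop_mono (fun n => by linarith [hT n]) tendsto_natCast_atTop_atTop
  have hinv := flowInvariant_of_tendsto_empiricalMeasure Φ hTlim (fun n => rfl) hlim
  have hport := ProbabilityMeasure.limsup_measure_closed_le_of_tendsto hlim (isClosed_cyl Φ hBc η)
  rw [h μ inferInstance hinv] at hport
  have hle : ENNReal.ofReal (ε * η / 2) ≤
      limsup (fun n => (ν n : Measure X) (cyl Φ B η)) (hyperfilter ℕ) :=
    le_limsup_of_frequently_le (Frequently.of_forall fun n =>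
      le_empiricalMeasure_cyl hBc hη hB (x n) (hT0 n) (hx n))
  have h0 := ENNReal.ofReal_eq_zero.1 (le_antisymm (hle.trans hport) zero_le)
  exact absurd h0 (not_le.2 (by positivity))

lemma measure_cyl_eq_zero_of_visits_lt [CompactSpace X] {Φ : Flow ℝ X} {B : Set X}
    (hBc : IsClosed B) {η : ℝ} (hη : 0 < η) (hB : IsCrossSection Φ B η)
    (h : ∀ ε > (0 : ℝ), ∃ T₀ > (0 : ℝ), ∀ T ≥ T₀, ∀ x : X,
      ((visits Φ B x T).ncard : ℝ) / T < ε)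
    (μ : Measure X) [IsProbabilityMeasure μ] (hμ : FlowInvariant Φ μ) : μ (cyl Φ B η) = 0 := by
  refine le_antisymm (ENNReal.le_of_forall_pos_le_add fun ε hε _ => ?_) zero_le
  have hε' : (0 : ℝ) < ε := hε
  obtain ⟨T₀, hT₀, hv⟩ := h (ε / (3 * η)) (by positivity)
  obtain ⟨n, hn⟩ := exists_nat_ge (T₀ / (3 * η))
  rw [div_le_iff₀ (by positivity), mul_comm] at hn
  have hn0 : 0 < n := by
    rcases Nat.eq_zero_or_pos n with rfl | hn0
    · simp at hn
      linarith
    · exact hn0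
  rw [zero_add, ← ENNReal.ofReal_coe_nnreal]
  refine measure_cyl_le_of_ncard_visits_le hμ hBc hη hB hn0 fun x => ?_
  have hx := hv _ hn x
  rw [div_lt_iff₀ (hT₀.trans_le hn)] at hx
  refine hx.le.trans (le_of_eq ?_)
  field_simp

end Measure

/-- characterizations of the small flow boundary of a w.e.c. -/
theorem smallFlowBoundary_tfae {X : Type*} [MetricSpace X] [CompactSpace X]
    [MeasurableSpace X] [BorelSpace X]
    (Φ : Flow ℝ X) (hreg : Regular Φ) (S : Set X) (η : ℝ) (hη : 0 < η)
    (hS : IsWec Φ S η) :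
    ((∀ μ : Measure X, IsProbabilityMeasure μ → FlowInvariant Φ μ →
        μ (flowBoundaryCyl Φ S η η) = 0) ↔
      (∀ μ : Measure X, IsProbabilityMeasure μ → FlowInvariant Φ μ →
        Tendsto (fun ζ : ℝ => μ (flowBoundaryCyl Φ S η ζ) / ENNReal.ofReal ζ)
          (nhdsWithin 0 (Ioi 0)) (nhds 0))) ∧
    ((∀ μ : Measure X, IsProbabilityMeasure μ → FlowInvariant Φ μ →
        μ (flowBoundaryCyl Φ S η η) = 0) ↔
      (∀ ε > (0 : ℝ), ∃ T₀ > (0 : ℝ), ∀ T ≥ T₀, ∀ x : X,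
        (({t : ℝ | t ∈ Ioo 0 T ∧ Φ t x ∈ flowBoundary Φ S η}.ncard : ℝ)) / T < ε)) := by
  have hBc := isClosed_flowBoundary hη hS
  have hB := isCrossSection_flowBoundary hS
  refine ⟨?_, ?_⟩
  · exact forall_congr' fun μ => forall_congr' fun _ => forall_congr' fun hμ =>
      measure_cyl_eq_zero_iff_tendsto hμ hBc hη
  · exact ⟨fun h ε hε => exists_forall_visits_lt hBc hη hB h hε,
      fun h μ _ hμ => measure_cyl_eq_zero_of_visits_lt hBc hη hB h μ hμ⟩

end FlowPaper
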